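/- For every z ∈ ℂ the following identity holds, where all integrands are evaluated at (x,z) and the boundary factors at (L,z): 2Δ'(z) = ỹ₁₁(L,z)·∫₀ᴸ (ỹ₂₁ỹ₂₂ + ỹ₁₁ỹ₁₂) dx − ỹ₁₂(L,z)·∫₀ᴸ (ỹ₂₁² + ỹ₁₁²) dx + ỹ₂₁(L,z)·∫₀ᴸ (ỹ₂₂² + ỹ₁₂²) dx − ỹ₂₂(L,z)·∫₀ᴸ (ỹ₁₁ỹ₁₂ + ỹ₂₁ỹ₂₂) dx, where Δ'(z) denotes the complex derivative of the Floquet discriminant Δ(z) = (1/2) tr Y(L,z). -/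

import Mathlib

noncomputable section

/-- The third Pauli matrix. -/
def sigma3 : Matrix (Fin 2) (Fin 2) ℂ := !![1, 0; 0, -1]

/-- The matrix potential `Q(x)`. -/
def Qmat (q : ℝ → ℂ) (x : ℝ) : Matrix (Fin 2) (Fin 2) ℂ :=
  !![0, q x; (starRingEnd ℂ) (q x), 0]

/-- The similarity transformation matrix `U`. -/
def Umat : Matrix (Fin 2) (Fin 2) ℂ := !![1, 1; -Complex.I, Complex.I]

/-- `Ỹ(x,z) = U Y(x,z) U⁻¹`. -/
def Ytil (Y : ℂ → ℝ → Matrix (Fin 2) (Fin 2) ℂ) (z : ℂ) (x : ℝ) :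
    Matrix (Fin 2) (Fin 2) ℂ :=
  Umat * Y z x * Umat⁻¹

/-- A Gronwall bound: a solution of `u' = -i z u + q v`, `v' = i z v + conj q u` on `[0, L]`
starting in the unit ball is bounded by `exp ((‖z‖ + M) L)` when `‖q‖ ≤ M`. -/
lemma norm_solution_le {L M : ℝ} {q u v : ℝ → ℂ} {z : ℂ}
    (hM : ∀ x ∈ Set.Icc 0 L, ‖q x‖ ≤ M)
    (hu : ∀ x, HasDerivAt u (-(Complex.I * z) * u x + q x * v x) x)
    (hv : ∀ x, HasDerivAt v ((starRingEnd ℂ) (q x) * u x + Complex.I * z * v x) x)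
    (h0 : ‖(u 0, v 0)‖ ≤ 1) {x : ℝ} (hx : x ∈ Set.Icc 0 L) :
    ‖(u x, v x)‖ ≤ Real.exp ((‖z‖ + M) * L) := by
  have hM0 : 0 ≤ M := (norm_nonneg _).trans (hM x hx)
  have hK : 0 ≤ ‖z‖ + M := add_nonneg (norm_nonneg _) hM0
  have key := norm_le_gronwallBound_of_norm_deriv_right_le (δ := 1) (K := ‖z‖ + M) (ε := 0)
    (f := fun t => (u t, v t)) (a := 0) (b := L)
    (fun t _ => ((hu t).prodMk (hv t)).continuousAt.continuousWithinAt)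
    (fun t _ => ((hu t).prodMk (hv t)).hasDerivWithinAt) h0 (fun t ht => ?_) x hx
  · rw [gronwallBound_ε0, one_mul, sub_zero] at key
    exact key.trans (Real.exp_le_exp.2 (mul_le_mul_of_nonneg_left hx.2 hK))
  · have hq := hM t (Set.Ico_subset_Icc_self ht)
    have h1 : ‖u t‖ ≤ ‖(u t, v t)‖ := norm_fst_le (u t, v t)
    have h2 : ‖v t‖ ≤ ‖(u t, v t)‖ := norm_snd_le (u t, v t)
    rw [add_zero, add_mul]
    refine norm_prod_le_iff.2 ⟨(norm_add_le _ _).trans ?_, (norm_add_le _ _).trans ?_⟩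
    · simp only [norm_mul, norm_neg, Complex.norm_I, one_mul]
      gcongr
    · simp only [norm_mul, Complex.norm_I, one_mul, RCLike.norm_conj]
      rw [add_comm]
      gcongr

lemma Umat_inv : Umat⁻¹ = !![1 / 2, Complex.I / 2; 1 / 2, -(Complex.I / 2)] := by
  refine Matrix.inv_eq_right_inv ?_
  ext i j
  fin_cases i <;> fin_cases j <;>
    simp [Umat, Matrix.mul_apply, Fin.sum_univ_two] <;> ring_nf 
  norm_num [Complex.I_sq]

lemma Ytil_eq (Y : ℂ → ℝ → Matrix (Fin 2) (Fin 2) ℂ) (z : ℂ) (x : ℝ) :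
    Ytil Y z x =
      !![(Y z x 0 0 + Y z x 0 1 + Y z x 1 0 + Y z x 1 1) / 2,
          Complex.I * (Y z x 0 0 - Y z x 0 1 + Y z x 1 0 - Y z x 1 1) / 2;
        Complex.I * (-Y z x 0 0 - Y z x 0 1 + Y z x 1 0 + Y z x 1 1) / 2,
          (Y z x 0 0 - Y z x 0 1 - Y z x 1 0 + Y z x 1 1) / 2] := by
  rw [Ytil, Umat_inv]
  ext i j
  fin_cases i <;> fin_cases j <;>
    simp [Umat, Matrix.mul_apply, Matrix.vecMul, dotProduct] <;> ring_nf
  simp only [Complex.I_sq]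
  ring

/-- `tr (P adj(A) (-i σ₃) B)`, written out in entries. -/
def traceKernel (P A B : Matrix (Fin 2) (Fin 2) ℂ) : ℂ :=
  -Complex.I *
    (P 0 0 * (A 1 1 * B 0 0 + A 0 1 * B 1 0) + P 0 1 * (-A 1 0 * B 0 0 - A 0 0 * B 1 0) +
      P 1 0 * (A 1 1 * B 0 1 + A 0 1 * B 1 1) + P 1 1 * (-A 1 0 * B 0 1 - A 0 0 * B 1 1))

section Solution

variable {L : ℝ} {q : ℝ → ℂ} {Y : ℂ → ℝ → Matrix (Fin 2) (Fin 2) ℂ}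

lemma hasDerivAt_solution_zero
    (hODE : ∀ (z : ℂ) (x : ℝ) (i j : Fin 2), HasDerivAt (fun t => Y z t i j)
      ((((-(Complex.I * z)) • sigma3 + Qmat q x) * Y z x) i j) x) (z : ℂ) (x : ℝ) (j : Fin 2) :
    HasDerivAt (fun t => Y z t 0 j) (-(Complex.I * z) * Y z x 0 j + q x * Y z x 1 j) x := by
  simpa [sigma3, Qmat, Matrix.mul_apply, Fin.sum_univ_two] using hODE z x 0 j

lemma hasDerivAt_solution_one
    (hODE : ∀ (z : ℂ) (x : ℝ) (i j : Fin 2), HasDerivAt (fun t => Y z t i j)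
      ((((-(Complex.I * z)) • sigma3 + Qmat q x) * Y z x) i j) x) (z : ℂ) (x : ℝ) (j : Fin 2) :
    HasDerivAt (fun t => Y z t 1 j)
      ((starRingEnd ℂ) (q x) * Y z x 0 j + Complex.I * z * Y z x 1 j) x := by
  simpa [sigma3, Qmat, Matrix.mul_apply, Fin.sum_univ_two] using hODE z x 1 j

lemma det_solution_eq_one (hY0 : ∀ z, Y z 0 = 1)
    (hODE : ∀ (z : ℂ) (x : ℝ) (i j : Fin 2), HasDerivAt (fun t => Y z t i j)
      ((((-(Complex.I * z)) • sigma3 + Qmat q x) * Y z x) i j) x) (z : ℂ) (x : ℝ) :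
    Y z x 0 0 * Y z x 1 1 - Y z x 0 1 * Y z x 1 0 = 1 := by
  have hd : ∀ t, HasDerivAt
      (fun t => Y z t 0 0 * Y z t 1 1 - Y z t 0 1 * Y z t 1 0) 0 t := fun t => by
    refine (((hasDerivAt_solution_zero hODE z t 0).mul (hasDerivAt_solution_one hODE z t 1)).sub
      ((hasDerivAt_solution_zero hODE z t 1).mul
        (hasDerivAt_solution_one hODE z t 0))).congr_deriv ?_
    ring
  have := is_const_of_deriv_eq_zero (fun t => (hd t).differentiableAt) (fun t => (hd t).deriv) x 0
  simpa [hY0] using this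

/-- The difference of the traces of the monodromy matrices at two spectral parameters, by
variation of parameters. -/
lemma trace_sub_trace_eq_integral (hY0 : ∀ z, Y z 0 = 1)
    (hODE : ∀ (z : ℂ) (x : ℝ) (i j : Fin 2), HasDerivAt (fun t => Y z t i j)
      ((((-(Complex.I * z)) • sigma3 + Qmat q x) * Y z x) i j) x) (z w : ℂ) :
    (Y w L).trace - (Y z L).trace =
      (w - z) * ∫ x in (0:ℝ)..L, traceKernel (Y z L) (Y z x) (Y w x) := by
  have hc : ∀ z i j, Continuous fun t => Y z t i j := fun z i j =>
    continuous_iff_continuousAt.2 fun t => (hODE z t i j).continuousAt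
  have h0 := hasDerivAt_solution_zero hODE
  have h1 := hasDerivAt_solution_one hODE
  set P := Y z L with hP
  have hd : ∀ t, HasDerivAt (fun t =>
      P 0 0 * (Y z t 1 1 * Y w t 0 0 - Y z t 0 1 * Y w t 1 0) +
      P 0 1 * (Y z t 0 0 * Y w t 1 0 - Y z t 1 0 * Y w t 0 0) +
      P 1 0 * (Y z t 1 1 * Y w t 0 1 - Y z t 0 1 * Y w t 1 1) +
      P 1 1 * (Y z t 0 0 * Y w t 1 1 - Y z t 1 0 * Y w t 0 1))
      ((w - z) * traceKernel P (Y z t) (Y w t)) t := fun t => by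
    refine ((((((((h1 z t 1).mul (h0 w t 0)).sub ((h0 z t 1).mul (h1 w t 0))).const_mul _).add
      ((((h0 z t 0).mul (h1 w t 0)).sub ((h1 z t 0).mul (h0 w t 0))).const_mul _)).add
      ((((h1 z t 1).mul (h0 w t 1)).sub ((h0 z t 1).mul (h1 w t 1))).const_mul _)).add
      ((((h0 z t 0).mul (h1 w t 1)).sub ((h1 z t 0).mul (h0 w t 1))).const_mul _))).congr_deriv ?_
    simp only [traceKernel]
    ring
  have hint := intervalIntegral.integral_eq_sub_of_hasDerivAt (a := 0) (b := L)
    (fun t _ => hd t) (Continuous.intervalIntegrable (by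
      simp only [traceKernel]
      have := hc z; have := hc w
      fun_prop) _ _)
  rw [intervalIntegral.integral_const_mul] at hint
  rw [hint]
  have hdet := det_solution_eq_one hY0 hODE z L
  simp only [← hP] at hdet ⊢
  simp only [hY0, Matrix.trace_fin_two, Matrix.one_apply_eq, ne_eq, zero_ne_one, one_ne_zero,
    not_false_eq_true, Matrix.one_apply_ne]
  linear_combination -(Y w L 0 0 + Y w L 1 1) * hdet

open Filter Topology in
lemma hasDerivAt_trace_solution (hL : 0 < L) (hq : Continuous q) (hY0 : ∀ z, Y z 0 = 1)
    (hODE : ∀ (z : ℂ) (x : ℝ) (i j : Fin 2), HasDerivAt (fun t => Y z t i j)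
      ((((-(Complex.I * z)) • sigma3 + Qmat q x) * Y z x) i j) x)
    (hcont : ∀ (x : ℝ) (i j : Fin 2), Continuous (fun z => Y z x i j)) (z : ℂ) :
    HasDerivAt (fun w => (Y w L).trace)
      (∫ x in (0:ℝ)..L, traceKernel (Y z L) (Y z x) (Y z x)) z := by
  have hc : ∀ z i j, Continuous fun t => Y z t i j := fun z i j =>
    continuous_iff_continuousAt.2 fun t => (hODE z t i j).continuousAt
  obtain ⟨M, hM⟩ := isCompact_Icc.exists_bound_of_continuousOn
    (s := Set.Icc 0 L) hq.continuousOn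
  have hM0 : 0 ≤ M := (norm_nonneg _).trans (hM 0 ⟨le_rfl, hL.le⟩)
  have hbound : ∀ w x, x ∈ Set.Icc 0 L → ∀ i j,
      ‖Y w x i j‖ ≤ Real.exp ((‖w‖ + M) * L) := fun w x hx i j => by
    have h := norm_solution_le hM (fun t => hasDerivAt_solution_zero hODE w t j)
      (fun t => hasDerivAt_solution_one hODE w t j)
      (by fin_cases j <;> simp [hY0, Prod.norm_def]) hx
    fin_cases i
    · exact (norm_fst_le (Y w x 0 j, Y w x 1 j)).trans h
    · exact (norm_snd_le (Y w x 0 j, Y w x 1 j)).trans h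
  rw [hasDerivAt_iff_tendsto_slope]
  have hlim : Tendsto (fun w => ∫ x in (0:ℝ)..L, traceKernel (Y z L) (Y z x) (Y w x)) (𝓝 z)
      (𝓝 (∫ x in (0:ℝ)..L, traceKernel (Y z L) (Y z x) (Y z x))) := by
    set P := Y z L
    set C := Real.exp ((‖z‖ + 1 + M) * L)
    refine intervalIntegral.tendsto_integral_filter_of_dominated_convergence
      (fun x => ‖P 0 0‖ * (‖Y z x 1 1‖ * C + ‖Y z x 0 1‖ * C) +
        ‖P 0 1‖ * (‖Y z x 1 0‖ * C + ‖Y z x 0 0‖ * C) +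
        ‖P 1 0‖ * (‖Y z x 1 1‖ * C + ‖Y z x 0 1‖ * C) +
        ‖P 1 1‖ * (‖Y z x 1 0‖ * C + ‖Y z x 0 0‖ * C)) ?_ ?_ ?_ ?_
    · refine .of_forall fun w => Continuous.aestronglyMeasurable ?_
      simp only [traceKernel]
      have := hc z; have := hc w
      fun_prop
    · filter_upwards [Metric.ball_mem_nhds z one_pos] with w hw
      refine .of_forall fun x hx => ?_
      rw [Set.uIoc_of_le hL.le] at hx
      have hwz : ‖w‖ ≤ ‖z‖ + 1 := by
        have h1 : ‖w - z‖ < 1 := by simpa [dist_eq_norm] using hw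
        linarith [norm_le_norm_add_norm_sub z w, norm_sub_rev w z]
      have hB : ∀ i j, ‖Y w x i j‖ ≤ C := fun i j =>
        (hbound w x ⟨hx.1.le, hx.2⟩ i j).trans (Real.exp_le_exp.2 (by gcongr))
      simp only [traceKernel, norm_mul, norm_neg, Complex.norm_I, one_mul]
      refine norm_add₄_le.trans ?_
      simp only [norm_mul]
      have hadd : ∀ {a b : ℂ} {i j k l : Fin 2}, ‖a * Y w x i j + b * Y w x k l‖ ≤
          ‖a‖ * C + ‖b‖ * C := fun {a b i j k l} => by
        refine (norm_add_le _ _).trans ?_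
        simp only [norm_mul]
        gcongr <;> apply hB
      have hsub : ∀ {a b : ℂ} {i j k l : Fin 2}, ‖-a * Y w x i j - b * Y w x k l‖ ≤
          ‖a‖ * C + ‖b‖ * C := fun {a b i j k l} => by
        refine (norm_sub_le _ _).trans ?_
        simp only [norm_mul, norm_neg]
        gcongr <;> apply hB
      gcongr
      exacts [hadd, hsub, hadd, hsub]
    · refine Continuous.intervalIntegrable ?_ _ _
      have := hc z
      fun_prop
    · refine .of_forall fun x _ => ?_
      have : Continuous fun w => traceKernel P (Y z x) (Y w x) := by
        simp only [traceKernel]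
        have := hcont x
        fun_prop
      exact this.tendsto z
  refine (hlim.mono_left nhdsWithin_le_nhds).congr' ?_
  filter_upwards [self_mem_nhdsWithin] with w hw
  rw [slope_def_field, trace_sub_trace_eq_integral hY0 hODE z w,
    mul_div_cancel_left₀ _ (sub_ne_zero.2 hw)]

end Solution

/-- the derivative of the Floquet discriminant `Δ(z) = (1/2) tr Y(L,z)`
satisfies the integral identity
`2Δ'(z) = ỹ₁₁(L,z)·∫₀ᴸ(ỹ₂₁ỹ₂₂+ỹ₁₁ỹ₁₂) − ỹ₁₂(L,z)·∫₀ᴸ(ỹ₂₁²+ỹ₁₁²)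
  + ỹ₂₁(L,z)·∫₀ᴸ(ỹ₂₂²+ỹ₁₂²) − ỹ₂₂(L,z)·∫₀ᴸ(ỹ₁₁ỹ₁₂+ỹ₂₁ỹ₂₂)`. -/
theorem floquet_discriminant_derivative_identity
    (L : ℝ) (hL : 0 < L)
    (q : ℝ → ℂ) (hq : Continuous q) (hper : ∀ x, q (x + L) = q x)
    (Y : ℂ → ℝ → Matrix (Fin 2) (Fin 2) ℂ)
    (hY0 : ∀ z, Y z 0 = 1)
    (hODE : ∀ (z : ℂ) (x : ℝ) (i j : Fin 2),
      HasDerivAt (fun t => Y z t i j)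
        ((((-(Complex.I * z)) • sigma3 + Qmat q x) * Y z x) i j) x)
    (hHol : ∀ (x : ℝ) (i j : Fin 2), Differentiable ℂ (fun z => Y z x i j)) :
    ∀ z : ℂ,
      2 * deriv (fun w => (Y w L).trace / 2) z =
        Ytil Y z L 0 0 *
            (∫ x in (0:ℝ)..L, (Ytil Y z x 1 0 * Ytil Y z x 1 1 + Ytil Y z x 0 0 * Ytil Y z x 0 1))
          - Ytil Y z L 0 1 *
            (∫ x in (0:ℝ)..L, (Ytil Y z x 1 0 ^ 2 + Ytil Y z x 0 0 ^ 2))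
          + Ytil Y z L 1 0 *
            (∫ x in (0:ℝ)..L, (Ytil Y z x 1 1 ^ 2 + Ytil Y z x 0 1 ^ 2))
          - Ytil Y z L 1 1 *
            (∫ x in (0:ℝ)..L, (Ytil Y z x 0 0 * Ytil Y z x 0 1 + Ytil Y z x 1 0 * Ytil Y z x 1 1)) := by
  intro z
  have hc : ∀ i j, Continuous fun t => Y z t i j := fun i j =>
    continuous_iff_continuousAt.2 fun t => (hODE z t i j).continuousAt
  have hT : ∀ i j, Continuous fun t => Ytil Y z t i j := fun i j => by
    simp only [Ytil_eq]
    fin_cases i <;> fin_cases j <;> simp <;> fun_prop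
  rw [((hasDerivAt_trace_solution hL hq hY0 hODE (fun x i j => (hHol x i j).continuous)
    z).div_const 2).deriv, mul_div_cancel₀ _ two_ne_zero]
  simp only [← intervalIntegral.integral_const_mul]
  rw [← intervalIntegral.integral_sub, ← intervalIntegral.integral_add,
    ← intervalIntegral.integral_sub]
  · refine intervalIntegral.integral_congr fun x _ => ?_
    simp only [traceKernel, Ytil_eq, Matrix.of_apply, Matrix.cons_val', Matrix.cons_val_zero,
      Matrix.cons_val_one, Matrix.cons_val_fin_one]
    ring_nf
    simp only [Complex.I_pow_three]
    ring
  all_goals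
    refine Continuous.intervalIntegrable ?_ _ _
    fun_prop
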